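/- Let {I₁,…,I_s} be a partition of {1,…,m} into nonempty blocks and {J₁,…,J_t} a partition of {1,…,n} into nonempty blocks, with every row of A and every column of B nonzero. Let σ_A > 0 satisfy ‖A (Aᵀ u)‖₂ ≥ σ_A ‖Aᵀ u‖₂ for every u ∈ ℝ^m, σ_B > 0 satisfy ‖Bᵀ (B v)‖₂ ≥ σ_B ‖B v‖₂ for every v ∈ ℝ^n, β_A > 0 satisfy ‖A_{I_i,:} x‖₂ ≤ β_A ‖A_{I_i,:}‖_F ‖x‖₂ for all i and x, and β_B > 0 satisfy ‖B_{:,J_j} c‖₂ ≤ β_B ‖B_{:,J_j}‖_F ‖c‖₂ for all j and c. Let η ∈ (0,2), set the constant stepsize α = η/(β_A² β_B²), let X ∈ ℝ^{p×q} satisfy X − X* = Aᵀ W Bᵀ for some W ∈ ℝ^{m×n}, and for each block pair (i,j) define X'_{(i,j)} = X + α (A_{I_i,:})ᵀ (C_{I_i,J_j} − A_{I_i,:} X B_{:,J_j}) (B_{:,J_j})ᵀ / (‖A_{I_i,:}‖_F² ‖B_{:,J_j}‖_F²). Then ∑_{i=1}^s ∑_{j=1}^t (‖A_{I_i,:}‖_F²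 ‖B_{:,J_j}‖_F² / (‖A‖_F² ‖B‖_F²)) ‖X'_{(i,j)} − X*‖_F² ≤ (1 − η(2−η) σ_A² σ_B² / (‖A‖_F² β_A² ‖B‖_F² β_B²)) ‖X − X*‖_F². -/

import Mathlib

open Matrix

noncomputable def vecNormSq {α : Type*} [Fintype α] (x : α → ℝ) : ℝ := ∑ i, (x i) ^ 2

noncomputable def vecNorm {α : Type*} [Fintype α] (x : α → ℝ) : ℝ := Real.sqrt (vecNormSq x)

noncomputable def frobNormSq {α β : Type*} [Fintype α] [Fintype β] (M : Matrix α β ℝ) : ℝ :=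
  ∑ i, ∑ j, (M i j) ^ 2

noncomputable def frobNorm {α β : Type*} [Fintype α] [Fintype β] (M : Matrix α β ℝ) : ℝ :=
  Real.sqrt (frobNormSq M)

noncomputable def frobInner {α β : Type*} [Fintype α] [Fintype β] (U V : Matrix α β ℝ) : ℝ :=
  ∑ i, ∑ j, U i j * V i j

def IsMPInv {α β : Type*} [Fintype α] [Fintype β] (M : Matrix α β ℝ) (P : Matrix β α ℝ) : Prop :=
  M * P * M = M ∧ P * M * P = P ∧ (M * P)ᵀ = M * P ∧ (P * M)ᵀ = P * M

def rowSub {m p : ℕ} (A : Matrix (Fin m) (Fin p) ℝ) (I : Finset (Fin m)) :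
    Matrix {i // i ∈ I} (Fin p) ℝ := A.submatrix Subtype.val id

def colSub {q n : ℕ} (B : Matrix (Fin q) (Fin n) ℝ) (J : Finset (Fin n)) :
    Matrix (Fin q) {j // j ∈ J} ℝ := B.submatrix id Subtype.val

def subMat {m n : ℕ} (C : Matrix (Fin m) (Fin n) ℝ) (I : Finset (Fin m)) (J : Finset (Fin n)) :
    Matrix {i // i ∈ I} {j // j ∈ J} ℝ := C.submatrix Subtype.val Subtype.val

noncomputable def bilin {m p q n : ℕ} (A : Matrix (Fin m) (Fin p) ℝ) (B : Matrix (Fin q) (Fin n) ℝ)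
    (X : Matrix (Fin p) (Fin q) ℝ) (i : Fin m) (j : Fin n) : ℝ :=
  ∑ a, ∑ b, A i a * X a b * B b j

def rank1 {m p q n : ℕ} (A : Matrix (Fin m) (Fin p) ℝ) (B : Matrix (Fin q) (Fin n) ℝ)
    (i : Fin m) (j : Fin n) (s : ℝ) : Matrix (Fin p) (Fin q) ℝ :=
  Matrix.of fun a b => A i a * s * B b j

noncomputable def rowSubNorm {m p : ℕ} (A : Matrix (Fin m) (Fin p) ℝ) (I : Finset (Fin m)) :
    Matrix {i // i ∈ I} (Fin p) ℝ := Matrix.of fun i a => A i.val a / vecNorm (A i.val)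

noncomputable def colSubNorm {q n : ℕ} (B : Matrix (Fin q) (Fin n) ℝ) (J : Finset (Fin n)) :
    Matrix (Fin q) {j // j ∈ J} ℝ :=
  Matrix.of fun b j => B b j.val / vecNorm (fun b' => B b' j.val)

theorem aux_vsq_nonneg {α : Type*} [Fintype α] (x : α → ℝ) : 0 ≤ vecNormSq x :=
  Finset.sum_nonneg fun _ _ => sq_nonneg _

theorem aux_fsq_nonneg {α β : Type*} [Fintype α] [Fintype β] (M : Matrix α β ℝ) :
    0 ≤ frobNormSq M :=
  Finset.sum_nonneg fun _ _ => Finset.sum_nonneg fun _ _ => sq_nonneg _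

theorem aux_vn_sq {α : Type*} [Fintype α] (x : α → ℝ) : vecNorm x ^ 2 = vecNormSq x :=
  Real.sq_sqrt (aux_vsq_nonneg x)

theorem aux_fn_sq {α β : Type*} [Fintype α] [Fintype β] (M : Matrix α β ℝ) :
    frobNorm M ^ 2 = frobNormSq M :=
  Real.sq_sqrt (aux_fsq_nonneg M)

theorem aux_vn_nonneg {α : Type*} [Fintype α] (x : α → ℝ) : 0 ≤ vecNorm x := Real.sqrt_nonneg _

theorem aux_fsq_transpose {α β : Type*} [Fintype α] [Fintype β] (M : Matrix α β ℝ) :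
    frobNormSq Mᵀ = frobNormSq M := by
  unfold frobNormSq
  rw [Finset.sum_comm]
  rfl

theorem aux_fsq_cols {α β : Type*} [Fintype α] [Fintype β] (M : Matrix α β ℝ) :
    frobNormSq M = ∑ j, vecNormSq (M.col j) := by
  unfold frobNormSq vecNormSq
  rw [Finset.sum_comm]
  rfl

theorem aux_col_mul {α β γ : Type*} [Fintype β]
    (A : Matrix α β ℝ) (M : Matrix β γ ℝ) (j : γ) : (A * M).col j = A.mulVec (M.col j) := by
  ext i
  rfl

theorem aux_expand {α β : Type*} [Fintype α] [Fintype β] (E M : Matrix α β ℝ) (c : ℝ) :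
    frobNormSq (E - c • M) = frobNormSq E - 2 * c * frobInner E M + c ^ 2 * frobNormSq M := by
  unfold frobNormSq frobInner
  simp only [Finset.mul_sum, ← Finset.sum_sub_distrib, ← Finset.sum_add_distrib]
  refine Finset.sum_congr rfl fun i _ => Finset.sum_congr rfl fun j _ => ?_
  simp only [Matrix.sub_apply, Matrix.smul_apply, smul_eq_mul]
  ring

theorem aux_inner_trace {α β : Type*} [Fintype α] [Fintype β] (U V : Matrix α β ℝ) :
    frobInner U V = (Uᵀ * V).trace := by
  unfold frobInner Matrix.trace
  rw [Finset.sum_comm]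
  rfl

theorem aux_inner_self {α β : Type*} [Fintype α] [Fintype β] (U : Matrix α β ℝ) :
    frobInner U U = frobNormSq U := by
  unfold frobInner frobNormSq
  simp only [sq]

theorem aux_inner_adj {α β γ δ : Type*} [Fintype α] [Fintype β] [Fintype γ] [Fintype δ]
    (A : Matrix α β ℝ) (E : Matrix β γ ℝ) (B : Matrix γ δ ℝ) (R : Matrix α δ ℝ) :
    frobInner E (Aᵀ * R * Bᵀ) = frobInner (A * E * B) R := by
  rw [aux_inner_trace, aux_inner_trace, ← Matrix.mul_assoc, Matrix.trace_mul_comm]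
  simp only [Matrix.transpose_mul, Matrix.mul_assoc]

theorem aux_transpose_bound {α β : Type*} [Fintype α] [Fintype β] (A : Matrix α β ℝ) (K : ℝ)
    (hK : 0 ≤ K) (h : ∀ x, vecNorm (A.mulVec x) ≤ K * vecNorm x) (u : α → ℝ) :
    vecNorm (Aᵀ.mulVec u) ≤ K * vecNorm u := by
  have h1 : vecNormSq (Aᵀ.mulVec u) = ∑ i, u i * (A.mulVec (Aᵀ.mulVec u)) i := by
    have : vecNormSq (Aᵀ.mulVec u) = (Aᵀ.mulVec u) ⬝ᵥ (Aᵀ.mulVec u) := by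
      unfold vecNormSq dotProduct
      simp only [sq]
    rw [this]
    change _ = u ⬝ᵥ (A.mulVec (Aᵀ.mulVec u))
    rw [Matrix.dotProduct_mulVec u A, ← Matrix.mulVec_transpose A u]
  have h2 : (∑ i, u i * (A.mulVec (Aᵀ.mulVec u)) i) ≤
      vecNorm u * vecNorm (A.mulVec (Aᵀ.mulVec u)) :=
    Real.sum_mul_le_sqrt_mul_sqrt _ _ _
  have h3 := h (Aᵀ.mulVec u)
  rw [← h1, ← aux_vn_sq] at h2
  set y := vecNorm (Aᵀ.mulVec u) with hy
  have hu := aux_vn_nonneg u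
  have hy0 : 0 ≤ y := aux_vn_nonneg _
  have h4 : y ^ 2 ≤ vecNorm u * (K * y) := h2.trans (mul_le_mul_of_nonneg_left h3 hu)
  rcases hy0.eq_or_lt with h0 | h0
  · rw [← h0]; positivity
  · nlinarith

theorem aux_mul_upper {α β γ : Type*} [Fintype α] [Fintype β] [Fintype γ] (A : Matrix α β ℝ)
    (K : ℝ) (h : ∀ x, vecNorm (A.mulVec x) ≤ K * vecNorm x) (M : Matrix β γ ℝ) :
    frobNormSq (A * M) ≤ K ^ 2 * frobNormSq M := by
  rw [aux_fsq_cols, aux_fsq_cols, Finset.mul_sum]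
  refine Finset.sum_le_sum fun j _ => ?_
  rw [aux_col_mul, ← aux_vn_sq, ← aux_vn_sq, ← mul_pow]
  exact pow_le_pow_left₀ (aux_vn_nonneg _) (h _) 2

theorem aux_mul_lower {α β γ : Type*} [Fintype α] [Fintype β] [Fintype γ] (A : Matrix α β ℝ)
    (σ : ℝ) (hσ : 0 < σ)
    (h : ∀ u, σ * vecNorm (Aᵀ.mulVec u) ≤ vecNorm (A.mulVec (Aᵀ.mulVec u)))
    (M : Matrix α γ ℝ) :
    σ ^ 2 * frobNormSq (Aᵀ * M) ≤ frobNormSq (A * (Aᵀ * M)) := by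
  rw [aux_fsq_cols, aux_fsq_cols, Finset.mul_sum]
  refine Finset.sum_le_sum fun j _ => ?_
  rw [aux_col_mul A, aux_col_mul Aᵀ, ← aux_vn_sq, ← aux_vn_sq, ← mul_pow]
  exact pow_le_pow_left₀ (mul_nonneg hσ.le (aux_vn_nonneg _)) (h _) 2

theorem aux_part_sum {m s : ℕ} (Ib : Fin s → Finset (Fin m))
    (hI : ∀ i : Fin m, ∃! a, i ∈ Ib a) (f : Fin m → ℝ) :
    ∑ a, ∑ i : {i // i ∈ Ib a}, f i.val = ∑ i, f i := by
  have h1 : ∀ a, ∑ i : {i // i ∈ Ib a}, f i.val = ∑ i, if i ∈ Ib a then f i else 0 := by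
    intro a
    rw [← Finset.sum_filter, Finset.filter_mem_eq_inter, Finset.univ_inter]
    exact Finset.sum_coe_sort (Ib a) f
  simp only [h1]
  rw [Finset.sum_comm]
  refine Finset.sum_congr rfl fun i _ => ?_
  obtain ⟨a, ha, hu⟩ := hI i
  rw [Finset.sum_eq_single a]
  · simp only [if_pos ha]
  · intro b _ hb
    exact if_neg fun hib => hb (hu b hib)
  · simp

theorem aux_fsq_pos {α β : Type*} [Fintype α] [Fintype β] (M : Matrix α β ℝ) (i : α)
    (h : M i ≠ 0) : 0 < frobNormSq M := by
  obtain ⟨j, hj⟩ := Function.ne_iff.mp h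
  have h1 : 0 < (M i j) ^ 2 := by
    have : M i j ≠ 0 := hj
    positivity
  refine h1.trans_le ?_
  refine (Finset.single_le_sum (f := fun j => (M i j) ^ 2) (fun _ _ => sq_nonneg _)
    (Finset.mem_univ j)).trans ?_
  exact Finset.single_le_sum (f := fun i => ∑ j, (M i j) ^ 2)
    (fun _ _ => Finset.sum_nonneg fun _ _ => sq_nonneg _) (Finset.mem_univ i)

/-- Single-block estimate. -/
theorem aux_block {α β γ δ : Type*} [Fintype α] [Fintype β] [Fintype γ] [Fintype δ]
    (A : Matrix α β ℝ) (E : Matrix β γ ℝ) (B : Matrix γ δ ℝ) (βA βB η : ℝ)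
    (hβA : 0 < βA) (hβB : 0 < βB)
    (hA0 : 0 < frobNormSq A) (hB0 : 0 < frobNormSq B)
    (hA : ∀ x, vecNorm (A.mulVec x) ≤ βA * frobNorm A * vecNorm x)
    (hB : ∀ x, vecNorm (B.mulVec x) ≤ βB * frobNorm B * vecNorm x) :
    frobNormSq A * frobNormSq B *
      frobNormSq (E - ((η / (βA ^ 2 * βB ^ 2)) / (frobNormSq A * frobNormSq B)) •
        (Aᵀ * (A * E * B) * Bᵀ)) ≤
      frobNormSq A * frobNormSq B * frobNormSq E -
        η * (2 - η) / (βA ^ 2 * βB ^ 2) * frobNormSq (A * E * B) := by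
  rw [aux_expand, aux_inner_adj, aux_inner_self]
  set R := A * E * B
  have h1 : frobNormSq (Aᵀ * R * Bᵀ) ≤
      (βA ^ 2 * frobNormSq A) * ((βB ^ 2 * frobNormSq B) * frobNormSq R) := by
    have e1 := aux_mul_upper Aᵀ (βA * frobNorm A)
      (aux_transpose_bound A _ (mul_nonneg hβA.le (Real.sqrt_nonneg _)) hA) (R * Bᵀ)
    have e2 := aux_mul_upper B (βB * frobNorm B) hB Rᵀ
    rw [← aux_fsq_transpose, Matrix.transpose_mul, Matrix.transpose_transpose,
      mul_pow, aux_fn_sq, aux_fsq_transpose] at e2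
    rw [mul_pow, aux_fn_sq, ← Matrix.mul_assoc] at e1
    exact e1.trans (mul_le_mul_of_nonneg_left e2 (by positivity))
  set a := frobNormSq A
  set b := frobNormSq B
  set r := frobNormSq R
  set z := frobNormSq (Aᵀ * R * Bᵀ)
  set c := η / (βA ^ 2 * βB ^ 2) / (a * b) with hc
  have h2 : a * b * (c ^ 2 * z) ≤
      a * b * (c ^ 2 * ((βA ^ 2 * a) * ((βB ^ 2 * b) * r))) := by gcongr
  have h3 : a * b * (c ^ 2 * ((βA ^ 2 * a) * ((βB ^ 2 * b) * r))) =
      η ^ 2 / (βA ^ 2 * βB ^ 2) * r := by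
    rw [hc]; field_simp
  have h4 : a * b * (2 * c * r) = 2 * η / (βA ^ 2 * βB ^ 2) * r := by
    rw [hc]; field_simp
  have h5 : η * (2 - η) / (βA ^ 2 * βB ^ 2) * r =
      2 * η / (βA ^ 2 * βB ^ 2) * r - η ^ 2 / (βA ^ 2 * βB ^ 2) * r := by ring
  rw [h5]
  linarith

/-- one-step expected error bound for the GRABK method with constant
stepsize `α = η/(β_A² β_B²)`, partition sampling, and the compact weighted update. -/
theorem grabk_const_step_expected_error {m p q n s t : ℕ}
    (A : Matrix (Fin m) (Fin p) ℝ) (B : Matrix (Fin q) (Fin n) ℝ)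
    (Xs : Matrix (Fin p) (Fin q) ℝ) (C : Matrix (Fin m) (Fin n) ℝ) (hC : C = A * Xs * B)
    (Ib : Fin s → Finset (Fin m)) (Jb : Fin t → Finset (Fin n))
    (hIne : ∀ a, (Ib a).Nonempty) (hJne : ∀ b, (Jb b).Nonempty)
    (hIpart : ∀ i : Fin m, ∃! a, i ∈ Ib a) (hJpart : ∀ j : Fin n, ∃! b, j ∈ Jb b)
    (hAnz : ∀ i, A i ≠ 0) (hBnz : ∀ j, (fun b => B b j) ≠ 0)
    (σA σB βA βB : ℝ) (hσA : 0 < σA) (hσB : 0 < σB) (hβA : 0 < βA) (hβB : 0 < βB)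
    (hA : ∀ u : Fin m → ℝ, σA * vecNorm (Aᵀ.mulVec u) ≤ vecNorm (A.mulVec (Aᵀ.mulVec u)))
    (hB : ∀ v : Fin n → ℝ, σB * vecNorm (B.mulVec v) ≤ vecNorm (Bᵀ.mulVec (B.mulVec v)))
    (hβA2 : ∀ a, ∀ x : Fin p → ℝ,
      vecNorm ((rowSub A (Ib a)).mulVec x) ≤ βA * frobNorm (rowSub A (Ib a)) * vecNorm x)
    (hβB2 : ∀ b, ∀ c : {j // j ∈ Jb b} → ℝ,
      vecNorm ((colSub B (Jb b)).mulVec c) ≤ βB * frobNorm (colSub B (Jb b)) * vecNorm c)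
    (η : ℝ) (hη : 0 < η) (hη2 : η < 2)
    (X : Matrix (Fin p) (Fin q) ℝ) (W : Matrix (Fin m) (Fin n) ℝ)
    (hX : X - Xs = Aᵀ * W * Bᵀ) :
    ∑ a, ∑ b,
        (frobNormSq (rowSub A (Ib a)) * frobNormSq (colSub B (Jb b)) /
            (frobNormSq A * frobNormSq B)) *
          frobNormSq ((X + ((η / (βA ^ 2 * βB ^ 2)) /
              (frobNormSq (rowSub A (Ib a)) * frobNormSq (colSub B (Jb b)))) •
              ((rowSub A (Ib a))ᵀ *
                (subMat C (Ib a) (Jb b) - rowSub A (Ib a) * X * colSub B (Jb b)) *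
                  (colSub B (Jb b))ᵀ)) - Xs)
      ≤ (1 - η * (2 - η) * σA ^ 2 * σB ^ 2 /
            (frobNormSq A * βA ^ 2 * frobNormSq B * βB ^ 2)) * frobNormSq (X - Xs) := by
  have hE : ∀ a b, (X + ((η / (βA ^ 2 * βB ^ 2)) /
              (frobNormSq (rowSub A (Ib a)) * frobNormSq (colSub B (Jb b)))) •
              ((rowSub A (Ib a))ᵀ *
                (subMat C (Ib a) (Jb b) - rowSub A (Ib a) * X * colSub B (Jb b)) *
                  (colSub B (Jb b))ᵀ)) - Xs =
      (X - Xs) - ((η / (βA ^ 2 * βB ^ 2)) /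
              (frobNormSq (rowSub A (Ib a)) * frobNormSq (colSub B (Jb b)))) •
              ((rowSub A (Ib a))ᵀ * (rowSub A (Ib a) * (X - Xs) * colSub B (Jb b)) *
                  (colSub B (Jb b))ᵀ) := by
    intro a b
    have hCs : subMat C (Ib a) (Jb b) = rowSub A (Ib a) * Xs * colSub B (Jb b) := by
      rw [hC]; rfl
    have : subMat C (Ib a) (Jb b) - rowSub A (Ib a) * X * colSub B (Jb b) =
        -(rowSub A (Ib a) * (X - Xs) * colSub B (Jb b)) := by
      rw [hCs, Matrix.mul_sub, Matrix.sub_mul, neg_sub]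
    rw [this, Matrix.mul_neg, Matrix.neg_mul, smul_neg]
    abel
  simp only [hE]
  have hlow : σA ^ 2 * σB ^ 2 * frobNormSq (X - Xs) ≤ frobNormSq (A * (X - Xs) * B) := by
    have e1 := aux_mul_lower A σA hσA hA (W * Bᵀ)
    rw [← Matrix.mul_assoc, ← hX] at e1
    have e2 := aux_mul_lower Bᵀ σB hσB (by simpa using hB) (A * Aᵀ * W)ᵀ
    have e3 : (Bᵀ)ᵀ * (A * Aᵀ * W)ᵀ = (A * (X - Xs))ᵀ := by
      rw [hX, ← Matrix.transpose_mul]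
      simp only [Matrix.mul_assoc]
    rw [e3, ← Matrix.transpose_mul, aux_fsq_transpose, aux_fsq_transpose] at e2
    have := mul_le_mul_of_nonneg_left e1 (sq_nonneg σB)
    linarith
  generalize X - Xs = E at *
  have hsumA : ∑ a, frobNormSq (rowSub A (Ib a)) = frobNormSq A :=
    aux_part_sum Ib hIpart fun i => ∑ j, (A i j) ^ 2
  have hsumB : ∑ b, frobNormSq (colSub B (Jb b)) = frobNormSq B := by
    rw [← aux_fsq_transpose B]
    refine Eq.trans ?_ (aux_part_sum Jb hJpart fun j => ∑ i, (Bᵀ j i) ^ 2)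
    refine Finset.sum_congr rfl fun b _ => ?_
    rw [← aux_fsq_transpose]
    rfl
  have hsumR : ∑ a, ∑ b, frobNormSq (rowSub A (Ib a) * E * colSub B (Jb b)) =
      frobNormSq (A * E * B) := by
    have h1 : ∀ a, ∑ b, frobNormSq (rowSub A (Ib a) * E * colSub B (Jb b)) =
        ∑ i : {i // i ∈ Ib a}, ∑ j, ((A * E * B) i.val j) ^ 2 := by
      intro a
      unfold frobNormSq
      rw [Finset.sum_comm]
      refine Finset.sum_congr rfl fun i _ => ?_
      exact aux_part_sum Jb hJpart fun j => ((A * E * B) i.val j) ^ 2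
    simp only [h1]
    exact aux_part_sum Ib hIpart fun i => ∑ j, ((A * E * B) i j) ^ 2
  have hApos : ∀ a, 0 < frobNormSq (rowSub A (Ib a)) := fun a => by
    obtain ⟨i, hi⟩ := hIne a
    exact aux_fsq_pos _ ⟨i, hi⟩ (hAnz i)
  have hBpos : ∀ b, 0 < frobNormSq (colSub B (Jb b)) := fun b => by
    obtain ⟨j, hj⟩ := hJne b
    rw [← aux_fsq_transpose]
    exact aux_fsq_pos _ ⟨j, hj⟩ (hBnz j)
  have hblock := fun a b => aux_block (rowSub A (Ib a)) E (colSub B (Jb b)) βA βB η hβA hβB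
    (hApos a) (hBpos b) (hβA2 a) (hβB2 b)
  rcases (aux_fsq_nonneg E).eq_or_lt with h0 | hE0
  · have hE1 : E = 0 := by
      ext i j
      have h2 := (Finset.sum_eq_zero_iff_of_nonneg
        (fun i _ => Finset.sum_nonneg fun j _ => sq_nonneg (E i j))).mp h0.symm i (Finset.mem_univ i)
      have h3 := (Finset.sum_eq_zero_iff_of_nonneg
        (fun j _ => sq_nonneg (E i j))).mp h2 j (Finset.mem_univ j)
      simpa using h3
    subst hE1
    simp [frobNormSq]
  have hm : 0 < frobNormSq A := by
    rcases Nat.eq_zero_or_pos m with rfl | hm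
    · exfalso
      rw [hX] at hE0
      simp [frobNormSq, Matrix.mul_apply] at hE0
    · exact aux_fsq_pos _ ⟨0, hm⟩ (hAnz _)
  have hn : 0 < frobNormSq B := by
    rcases Nat.eq_zero_or_pos n with rfl | hn
    · exfalso
      rw [hX] at hE0
      simp [frobNormSq, Matrix.mul_apply] at hE0
    · rw [← aux_fsq_transpose]
      exact aux_fsq_pos _ ⟨0, hn⟩ (hBnz _)
  have hk : 0 < η * (2 - η) / (βA ^ 2 * βB ^ 2) := by
    have : 0 < 2 - η := by linarith
    positivity
  have hS := Finset.sum_le_sum fun a (_ : a ∈ Finset.univ) =>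
    Finset.sum_le_sum fun b (_ : b ∈ Finset.univ) => hblock a b
  simp only [Finset.sum_sub_distrib, ← Finset.mul_sum, ← Finset.sum_mul, hsumR, hsumA, hsumB] at hS
  simp only [div_mul_eq_mul_div, ← Finset.sum_div]
  rw [div_le_iff₀ (by positivity)]
  have hR := mul_le_mul_of_nonneg_left hlow hk.le
  have hfin : (1 - η * (2 - η) * σA ^ 2 * σB ^ 2 /
            (frobNormSq A * βA ^ 2 * frobNormSq B * βB ^ 2)) * frobNormSq E *
            (frobNormSq A * frobNormSq B) =
      frobNormSq A * frobNormSq B * frobNormSq E -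
        η * (2 - η) / (βA ^ 2 * βB ^ 2) * (σA ^ 2 * σB ^ 2 * frobNormSq E) := by
    field_simp
  rw [hfin]
  linarith
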